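/- arXiv:2312.05604 — 2 statements merged into one kernel-verified Lean document; each statement's English description precedes it below -/
import Mathlib

section
/- With u_C and M_τ as above and 𝔇 = dim(C_λ^{d−1}), if s − (d − 𝔇)/p < 0 (with 0 < s < 1, 1 < p < ∞), then the Gagliardo-type energy J_p^s(u_C) = ∫∫_{3Ω × 3Ω} |u_C(y) − u_C(z)|^p / |y−z|^{d+sp} dy dz is finite, where Ω = (−1,1)^d. -/
open MeasureTheory Set Metric Filter
open scoped Pointwise ENNReal

/-- Stages of the middle-`(1-2l)` Cantor construction on `[-1/2, 1/2]`. -/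
def cantorStageMid (l : ℝ) : ℕ → Set ℝ
  | 0 => Set.Icc (-(1/2 : ℝ)) (1/2)
  | (k+1) => (fun x => l * x - (1 - l)/2) '' cantorStageMid l k ∪
      (fun x => l * x + (1 - l)/2) '' cantorStageMid l k

/-- The middle-`(1-2l)` Cantor set. -/
def cantorSetMid (l : ℝ) : Set ℝ := ⋂ k, cantorStageMid l k


lemma vol_affine (l b : ℝ) (hl : 0 < l) (S : Set ℝ) :
    volume ((fun x => l * x + b) '' S) = ENNReal.ofReal l * volume S := by
  have : (fun x => l * x + b) '' S = (fun x => x + b) '' (l • S) := by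
    ext y
    simp [Set.mem_smul_set, eq_sub_iff_add_eq, ← sub_eq_add_neg]
  rw [this, Set.image_add_right, measure_preimage_add_right, Measure.addHaar_smul]
  simp [abs_of_pos hl]

lemma thick_step (l ε : ℝ) (hl : 0 < l) (k : ℕ) :
    thickening ε (cantorStageMid l (k+1)) ⊆
      (fun x => l * x + (-((1 - l)/2))) '' thickening (ε / l) (cantorStageMid l k) ∪
      (fun x => l * x + (1 - l)/2) '' thickening (ε / l) (cantorStageMid l k) := by
  have key : ∀ (b x w : ℝ), w ∈ cantorStageMid l k → dist x (l * w + b) < ε →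
      x ∈ (fun x => l * x + b) '' thickening (ε / l) (cantorStageMid l k) := by
    intro b x w hw h
    refine ⟨(x - b) / l, ?_, by field_simp; ring⟩
    rw [mem_thickening_iff]
    refine ⟨w, hw, ?_⟩
    rw [Real.dist_eq] at *
    have : (x - b) / l - w = (x - (l * w + b)) / l := by field_simp; ring
    rw [this, abs_div, abs_of_pos hl]
    gcongr
  intro x hx
  rw [mem_thickening_iff] at hx
  obtain ⟨z, hz, h⟩ := hx
  rcases hz with ⟨w, hw, rfl⟩ | ⟨w, hw, rfl⟩
  · left
    exact key _ _ w hw (by simpa [sub_eq_add_neg] using h)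
  · right
    exact key _ _ w hw h

lemma vol_thick (l : ℝ) (hl : 0 < l) (k : ℕ) : ∀ ε : ℝ, 0 < ε →
    volume (thickening ε (cantorStageMid l k)) ≤ ENNReal.ofReal ((2 * l) ^ k * (1 + 2 * ε / l ^ k)) := by
  induction k with
  | zero =>
    intro ε hε
    calc _ ≤ volume (Set.Icc (-(1/2:ℝ) - ε) (1/2 + ε)) := by
          apply measure_mono
          intro x hx
          rw [mem_thickening_iff] at hx
          obtain ⟨z, hz, h⟩ := hx
          simp only [cantorStageMid, Set.mem_Icc] at hz
          rw [Real.dist_eq, abs_lt] at h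
          constructor <;> linarith [hz.1, hz.2, h.1, h.2]
      _ ≤ _ := by
          rw [Real.volume_Icc]
          apply ENNReal.ofReal_le_ofReal
          simp; linarith
  | succ k ih =>
    intro ε hε
    refine (measure_mono (thick_step l ε hl k)).trans ((measure_union_le _ _).trans ?_)
    rw [vol_affine _ _ hl, vol_affine _ _ hl]
    have := ih (ε / l) (by positivity)
    calc _ ≤ ENNReal.ofReal l * ENNReal.ofReal ((2 * l) ^ k * (1 + 2 * (ε / l) / l ^ k)) + ENNReal.ofReal l * ENNReal.ofReal ((2 * l) ^ k * (1 + 2 * (ε / l) / l ^ k)) := by gcongr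
      _ = _ := by
        rw [← ENNReal.ofReal_mul hl.le, ← ENNReal.ofReal_add (by positivity) (by positivity)]
        congr 1
        field_simp
        ring

lemma vol_cantor (l : ℝ) (hl : l ∈ Set.Ioo (0:ℝ) (1/2)) (t : ℝ) (ht : 0 < t) (ht3 : t ≤ 3) :
    volume (thickening (5 * t) (cantorSetMid l)) ≤ ENNReal.ofReal
      ((1 / (3 * l) + 10) * (3:ℝ) ^ (Real.log 2 / Real.log (1/l)) *
        t ^ (1 - Real.log 2 / Real.log (1/l))) := by
  obtain ⟨h0, h1⟩ := hl
  obtain ⟨k, hk1, hk2⟩ := exists_nat_pow_near_of_lt_one (x := t / 3) (y := l) (by positivity)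
    (by linarith) h0 (by linarith)
  set a := Real.log 2 / Real.log (1/l) with ha
  have hlog : 0 < Real.log (1/l) := Real.log_pos (by rw [lt_div_iff₀ h0]; linarith)
  have ha0 : 0 < a := div_pos (Real.log_pos (by norm_num)) hlog
  have h2 : l ^ (-a) = 2 := by
    rw [Real.rpow_def_of_pos h0]
    have : Real.log l * -a = Real.log 2 := by
      have e : Real.log (1/l) = - Real.log l := by simp
      rw [ha, e]
      rw [e] at hlog
      have : Real.log l ≠ 0 := by linarith
      field_simp
    rw [this, Real.exp_log (by norm_num)]
  have h2k : (2:ℝ) ^ k ≤ 3 ^ a * t ^ (-a) := by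
    calc (2:ℝ) ^ k = (l ^ k) ^ (-a) := by
          rw [← h2, ← Real.rpow_natCast, ← Real.rpow_natCast, ← Real.rpow_mul h0.le, ← Real.rpow_mul h0.le, mul_comm]
      _ ≤ (t / 3) ^ (-a) := Real.rpow_le_rpow_of_nonpos (by positivity) hk2 (by linarith)
      _ = _ := by
          rw [Real.div_rpow ht.le (by norm_num), Real.rpow_neg (by norm_num : (0:ℝ) ≤ 3)]
          field_simp
  calc _ ≤ volume (thickening (5 * t) (cantorStageMid l k)) :=
        measure_mono (thickening_subset_of_subset _ (Set.iInter_subset _ k))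
    _ ≤ _ := vol_thick l h0 k _ (by positivity)
    _ ≤ _ := by
      apply ENNReal.ofReal_le_ofReal
      have e : (2 * l) ^ k * (1 + 2 * (5 * t) / l ^ k) = 2 ^ k * (l ^ k + 10 * t) := by
        rw [mul_pow]; field_simp; ring
      rw [e]
      have e2 : l ^ k + 10 * t ≤ (1 / (3 * l) + 10) * t := by
        have : l ^ k ≤ 1 / (3 * l) * t := by
          rw [pow_succ] at hk1
          rw [div_mul_eq_mul_div, one_mul, le_div_iff₀ (by positivity)]
          linarith
        linarith
      calc _ ≤ (3 ^ a * t ^ (-a)) * ((1 / (3 * l) + 10) * t) := by gcongr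
        _ = _ := by
          rw [sub_eq_add_neg, Real.rpow_add ht, Real.rpow_one]; ring

lemma half_mem (l : ℝ) : (1/2 : ℝ) ∈ cantorSetMid l := by
  rw [cantorSetMid, Set.mem_iInter]
  intro k
  induction k with
  | zero => simp only [cantorStageMid, Set.mem_Icc]; norm_num
  | succ k ih => right; exact ⟨1/2, ih, by ring⟩

lemma vol_nbhd (n : ℕ) (l : ℝ) (hl : l ∈ Set.Ioo (0:ℝ) (1/2)) : ∃ K : ℝ, 0 ≤ K ∧
    ∀ t : ℝ, 0 < t → t ≤ 3 →
    volume {x : EuclideanSpace ℝ (Fin n) |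
      infDist x {x : EuclideanSpace ℝ (Fin n) | ∀ i, x i ∈ cantorSetMid l} ≤ 4 * t} ≤
    ENNReal.ofReal (K * t ^ (n - n * Real.log 2 / Real.log (1/l))) := by
  set a := Real.log 2 / Real.log (1/l) with ha
  have h0 := hl.1
  refine ⟨((1 / (3 * l) + 10) * (3:ℝ) ^ a) ^ n, by positivity, fun t ht ht3 => ?_⟩
  calc _ ≤ volume (WithLp.ofLp ⁻¹' (Set.univ.pi fun _ : Fin n => thickening (5 * t) (cantorSetMid l)) : Set (EuclideanSpace ℝ (Fin n))) := by
        apply measure_mono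
        intro x hx
        have hx' : infDist x {x : EuclideanSpace ℝ (Fin n) | ∀ i, x i ∈ cantorSetMid l} < 5 * t :=
          lt_of_le_of_lt hx (by linarith)
        have hne : {x : EuclideanSpace ℝ (Fin n) | ∀ i, x i ∈ cantorSetMid l}.Nonempty :=
          ⟨WithLp.toLp 2 (fun _ => 1/2), fun i => half_mem l⟩
        rw [infDist_lt_iff hne] at hx'
        obtain ⟨y, hy, h⟩ := hx'
        intro i _
        rw [mem_thickening_iff]
        refine ⟨y i, hy i, lt_of_le_of_lt ?_ h⟩
        rw [dist_eq_norm, dist_eq_norm]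
        exact PiLp.norm_apply_le (x - y) i
    _ = ∏ i : Fin n, volume (thickening (5 * t) (cantorSetMid l)) := by
        rw [(PiLp.volume_preserving_ofLp (Fin n)).measure_preimage, volume_pi_pi]
        exact (MeasurableSet.univ_pi fun _ => isOpen_thickening.measurableSet).nullMeasurableSet
    _ ≤ ∏ i : Fin n, ENNReal.ofReal
      ((1 / (3 * l) + 10) * (3:ℝ) ^ a * t ^ (1 - a)) := Finset.prod_le_prod' fun _ _ => vol_cantor l hl t ht ht3
    _ = _ := by
      rw [Finset.prod_const, Finset.card_univ, Fintype.card_fin, ← ENNReal.ofReal_pow (by positivity), mul_pow,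
        ← Real.rpow_natCast (t ^ (1 - a)), ← Real.rpow_mul ht.le]
      congr 3
      rw [ha]; ring

/-- radial kernel profile -/
noncomputable def gker (C p e : ℝ) (t : ℝ) : ℝ := (min 1 (C * t)) ^ p / t ^ e

lemma gker_meas (C p e : ℝ) : Measurable (gker C p e) := by
  unfold gker
  fun_prop

lemma haar_inst (n : ℕ) :
    (volume : Measure (EuclideanSpace ℝ (Fin n) × ℝ)).IsAddHaarMeasure :=
  Measure.prod.instIsAddHaarMeasure _ _

lemma K0_fin (n : ℕ) (C p s : ℝ) (hC : 0 < C) (hp : 1 < p) (hs : s ∈ Set.Ioo (0:ℝ) 1) :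
    ∫⁻ w : EuclideanSpace ℝ (Fin n) × ℝ, ENNReal.ofReal (gker C p ((n:ℝ) + 1 + s * p) ‖w‖) < ⊤ := by
  have hI : Integrable (fun w : EuclideanSpace ℝ (Fin n) × ℝ => gker C p ((n:ℝ) + 1 + s * p) ‖w‖) := by
    have := haar_inst n
    rw [integrable_fun_norm_addHaar volume (f := gker C p ((n:ℝ) + 1 + s * p))]
    have hdim : Module.finrank ℝ (EuclideanSpace ℝ (Fin n) × ℝ) - 1 = n := by simp
    rw [hdim]
    have hsp : 0 < s * p := mul_pos hs.1 (by linarith)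
    have hsp2 : s * p < p := by nlinarith [hs.2]
    have hm : Measurable (fun y : ℝ => y ^ n • gker C p ((n:ℝ) + 1 + s * p) y) :=
      (measurable_id.pow_const n).smul (gker_meas _ _ _)
    have hid : ∀ y : ℝ, 0 < y → y ^ n / y ^ ((n:ℝ) + 1 + s * p) = y ^ (-1 - s * p) := by
      intro y hy
      rw [← Real.rpow_natCast, ← Real.rpow_sub hy]
      congr 1; ring
    rw [← Set.Ioo_union_Ici_eq_Ioi (zero_lt_one' ℝ)]
    apply IntegrableOn.union
    · have h1 : IntegrableOn (fun y : ℝ => C ^ p * y ^ (p - 1 - s * p)) (Set.Ioo 0 1) :=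
        ((intervalIntegral.integrableOn_Ioo_rpow_iff zero_lt_one).2 (by linarith)).const_mul _
      refine Integrable.mono' h1 hm.aestronglyMeasurable ?_
      filter_upwards [ae_restrict_mem measurableSet_Ioo] with y hy
      have hy0 := hy.1
      have hmin : 0 ≤ min 1 (C * y) := le_min zero_le_one (by positivity)
      rw [gker, smul_eq_mul, Real.norm_of_nonneg (by positivity)]
      calc _ ≤ y ^ n * ((C * y) ^ p / y ^ ((n:ℝ) + 1 + s * p)) := by
            gcongr
            exact min_le_right _ _
        _ = (C * y) ^ p * (y ^ n / y ^ ((n:ℝ) + 1 + s * p)) := by ring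
        _ = _ := by
          rw [hid y hy0, Real.mul_rpow hC.le hy0.le, mul_assoc, ← Real.rpow_add hy0]
          congr 2; ring
    · rw [integrableOn_Ici_iff_integrableOn_Ioi]
      have h1 : IntegrableOn (fun y : ℝ => y ^ (-1 - s * p)) (Set.Ioi 1) :=
        integrableOn_Ioi_rpow_of_lt (by linarith) zero_lt_one
      refine Integrable.mono' h1 hm.aestronglyMeasurable ?_
      filter_upwards [ae_restrict_mem measurableSet_Ioi] with y hy
      have hy0 : 0 < y := lt_trans zero_lt_one hy
      have hmin : 0 ≤ min 1 (C * y) := le_min zero_le_one (by positivity)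
      rw [gker, smul_eq_mul, Real.norm_of_nonneg (by positivity), ← hid y hy0]
      rw [div_eq_mul_one_div (y ^ n)]
      gcongr
      exact Real.rpow_le_one hmin (min_le_left _ _) (by linarith)
  have := hI.hasFiniteIntegral
  rw [hasFiniteIntegral_iff_norm] at this
  refine lt_of_le_of_lt (lintegral_mono fun w => ENNReal.ofReal_le_ofReal (Real.le_norm_self _)) this

lemma scale (n : ℕ) (C p s r : ℝ) (hr : 0 < r) (y : EuclideanSpace ℝ (Fin n) × ℝ) :
    ∫⁻ z : EuclideanSpace ℝ (Fin n) × ℝ,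
      ENNReal.ofReal ((min 1 (C * dist y z / r)) ^ p / dist y z ^ ((n:ℝ) + 1 + s * p)) =
    ENNReal.ofReal (r ^ (-(s * p))) *
      ∫⁻ w : EuclideanSpace ℝ (Fin n) × ℝ, ENNReal.ofReal (gker C p ((n:ℝ) + 1 + s * p) ‖w‖) := by
  have := haar_inst n
  set e := (n:ℝ) + 1 + s * p with he
  have hpt : ∀ w : EuclideanSpace ℝ (Fin n) × ℝ,
      (min 1 (C * ‖w‖ / r)) ^ p / ‖w‖ ^ e = r ^ (-e) * gker C p e ‖r⁻¹ • w‖ := by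
    intro w
    rw [gker, norm_smul, Real.norm_of_nonneg (by positivity), Real.mul_rpow (by positivity) (by positivity), Real.inv_rpow hr.le, Real.rpow_neg hr.le]
    have : C * ‖w‖ / r = C * (r⁻¹ * ‖w‖) := by ring
    rw [this]
    have := (Real.rpow_pos_of_pos hr e).ne'
    field_simp
  have hG : Measurable fun w : EuclideanSpace ℝ (Fin n) × ℝ => ENNReal.ofReal (gker C p e ‖w‖) :=
    ((gker_meas C p e).comp measurable_norm).ennreal_ofReal
  calc _ = ∫⁻ z : EuclideanSpace ℝ (Fin n) × ℝ,
        (fun w => ENNReal.ofReal ((min 1 (C * ‖w‖ / r)) ^ p / ‖w‖ ^ e)) (y - z) := by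
        simp only [dist_eq_norm]
    _ = ∫⁻ w : EuclideanSpace ℝ (Fin n) × ℝ, ENNReal.ofReal ((min 1 (C * ‖w‖ / r)) ^ p / ‖w‖ ^ e) :=
        lintegral_sub_left_eq_self (μ := (volume : Measure (EuclideanSpace ℝ (Fin n) × ℝ)))
          (fun w => ENNReal.ofReal ((min 1 (C * ‖w‖ / r)) ^ p / ‖w‖ ^ e)) y
    _ = ∫⁻ w : EuclideanSpace ℝ (Fin n) × ℝ, ENNReal.ofReal (r ^ (-e)) * ENNReal.ofReal (gker C p e ‖r⁻¹ • w‖) := by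
        congr 1; ext w
        rw [hpt, ENNReal.ofReal_mul (by positivity)]
    _ = ENNReal.ofReal (r ^ (-e)) * ∫⁻ w : EuclideanSpace ℝ (Fin n) × ℝ, ENNReal.ofReal (gker C p e ‖r⁻¹ • w‖) := by
        rw [lintegral_const_mul]
        exact hG.comp (measurable_const_smul r⁻¹)
    _ = ENNReal.ofReal (r ^ (-e)) * ∫⁻ w, ENNReal.ofReal (gker C p e ‖w‖) ∂(Measure.map (r⁻¹ • ·) (volume : Measure (EuclideanSpace ℝ (Fin n) × ℝ))) := by
        rw [lintegral_map hG (measurable_const_smul r⁻¹)]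
    _ = _ := by
        rw [Measure.map_addHaar_smul _ (by positivity), lintegral_smul_measure, smul_eq_mul, ← mul_assoc,
          ← ENNReal.ofReal_mul (by positivity)]
        congr 2
        have : Module.finrank ℝ (EuclideanSpace ℝ (Fin n) × ℝ) = n + 1 := by simp
        rw [this, abs_of_pos (by positivity), inv_pow, inv_inv, ← Real.rpow_natCast, ← Real.rpow_add hr]
        congr 1
        push_cast; rw [he]; ring

lemma lip (n : ℕ) (C0 : Set (EuclideanSpace ℝ (Fin n)))
    (ρ : (EuclideanSpace ℝ (Fin n) × ℝ) → ℝ)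
    (h0 : ∀ x, 0 ≤ ρ x) (h1 : ∀ x, ρ x ≤ 1)
    (hsmooth : ContDiffOn ℝ (⊤ : ℕ∞) ρ {x : EuclideanSpace ℝ (Fin n) × ℝ |
      ¬(x.1 ∈ C0 ∧ x.2 = 0)})
    (c₁ : ℝ)
    (hgrad : ∀ x : EuclideanSpace ℝ (Fin n) × ℝ, ‖fderiv ℝ ρ x‖ ≤ |c₁| * |x.2|⁻¹)
    (u : (EuclideanSpace ℝ (Fin n) × ℝ) → ℝ)
    (hu : ∀ x, u x = (1/2) * Real.sign x.2 * ρ x) (y z : EuclideanSpace ℝ (Fin n) × ℝ)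
    (hy : y.2 ≠ 0) : |u y - u z| ≤ min 1 ((2 + |c₁|) * dist y z / |y.2|) := by
  have hr : 0 < |y.2| := abs_pos.2 hy
  have hub : ∀ x, |u x| ≤ 1/2 := by
    intro x
    have hsg : |Real.sign x.2| ≤ 1 := by
      rcases Real.sign_apply_eq x.2 with h | h | h <;> rw [h] <;> norm_num
    rw [hu, abs_mul, abs_mul, abs_of_nonneg (h0 x), abs_of_pos (by norm_num : (0:ℝ) < 1/2)]
    nlinarith [h0 x, h1 x, abs_nonneg (Real.sign x.2)]
  have hd1 : |u y - u z| ≤ 1 := by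
    have := abs_sub (u y) (u z)
    linarith [hub y, hub z]
  refine le_min hd1 ?_
  by_cases hfar : |y.2| / 2 ≤ dist y z
  · refine hd1.trans ?_
    rw [le_div_iff₀ hr]
    nlinarith [abs_nonneg c₁, dist_nonneg (x := y) (y := z)]
  · push Not at hfar
    have hball : ∀ x ∈ ball y (|y.2| / 2), |x.2 - y.2| < |y.2| / 2 := by
      intro x hx
      rw [mem_ball] at hx
      exact lt_of_le_of_lt (by rw [← Real.dist_eq]; exact le_max_right _ _) hx
    have hlow : ∀ x ∈ ball y (|y.2| / 2), |y.2| / 2 ≤ |x.2| := by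
      intro x hx
      have := hball x hx
      have h3 := abs_sub_abs_le_abs_sub y.2 x.2
      rw [abs_sub_comm] at h3
      linarith
    have hzb : z ∈ ball y (|y.2| / 2) := by rwa [mem_ball, dist_comm]
    have hyb : y ∈ ball y (|y.2| / 2) := mem_ball_self (by positivity)
    have hL := Convex.norm_image_sub_le_of_norm_fderiv_le (𝕜 := ℝ) (f := ρ)
      (C := |c₁| * (|y.2| / 2)⁻¹) (s := ball y (|y.2| / 2)) (x := z) (y := y)
      (fun x hx => by
        have hx2 : x.2 ≠ 0 := by
          have := hlow x hx
          exact abs_pos.1 (by linarith)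
        refine (hsmooth.contDiffAt ?_).differentiableAt (by simp)
        have ho : IsOpen {x : EuclideanSpace ℝ (Fin n) × ℝ | x.2 ≠ 0} :=
          isOpen_ne_fun continuous_snd continuous_const
        exact mem_of_superset (ho.mem_nhds hx2) fun w hw h => hw h.2)
      (fun x hx => (hgrad x).trans (by have := hlow x hx; gcongr)) (convex_ball _ _) hzb hyb
    have hsign : Real.sign z.2 = Real.sign y.2 := by
      have := abs_lt.1 (hball z hzb)
      rcases lt_or_gt_of_ne hy with h | h
      · rw [abs_of_neg h] at this
        rw [Real.sign_of_neg h, Real.sign_of_neg (by linarith)]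
      · rw [abs_of_pos h] at this
        rw [Real.sign_of_pos h, Real.sign_of_pos (by linarith)]
    have habs : |Real.sign y.2| = 1 := by
      rcases lt_or_gt_of_ne hy with h | h
      · simp [Real.sign_of_neg h]
      · simp [Real.sign_of_pos h]
    have e : u y - u z = (1/2) * Real.sign y.2 * (ρ y - ρ z) := by
      rw [hu, hu, hsign]; ring
    rw [e, abs_mul, abs_mul, habs, abs_of_pos (by norm_num : (0:ℝ) < 1/2)]
    rw [← dist_eq_norm y z, Real.norm_eq_abs] at hL
    calc _ ≤ 1 / 2 * 1 * (|c₁| * (|y.2| / 2)⁻¹ * dist y z) := by gcongr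
      _ = |c₁| * dist y z / |y.2| := by field_simp
      _ ≤ _ := by gcongr; linarith

lemma cone_int (n : ℕ) (l : ℝ) (hl : l ∈ Set.Ioo (0:ℝ) (1/2)) (q : ℝ)
    (hq : q < (n:ℝ) + 1 - n * Real.log 2 / Real.log (1/l))
    (C0 : Set (EuclideanSpace ℝ (Fin n)))
    (hC0 : C0 = {x : EuclideanSpace ℝ (Fin n) | ∀ i, x i ∈ cantorSetMid l}) :
    ∫⁻ y : EuclideanSpace ℝ (Fin n) × ℝ, (if infDist y.1 C0 ≤ 4 * |y.2| ∧ |y.2| < 3 then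
      ENNReal.ofReal (|y.2| ^ (-q)) else 0) < ⊤ := by
  obtain ⟨K, hK, hvol⟩ := vol_nbhd n l hl
  rw [← hC0] at hvol
  set b := (n:ℝ) - n * Real.log 2 / Real.log (1/l) with hb
  have hset : MeasurableSet {y : EuclideanSpace ℝ (Fin n) × ℝ | infDist y.1 C0 ≤ 4 * |y.2| ∧ |y.2| < 3} := by
    have m1 : MeasurableSet {y : EuclideanSpace ℝ (Fin n) × ℝ | infDist y.1 C0 ≤ 4 * |y.2|} :=
      measurableSet_le (by fun_prop) (by fun_prop)
    have m2 : MeasurableSet {y : EuclideanSpace ℝ (Fin n) × ℝ | |y.2| < 3} :=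
      measurableSet_lt (by fun_prop) (by fun_prop)
    exact m1.inter m2
  have hm : Measurable fun y : EuclideanSpace ℝ (Fin n) × ℝ =>
      (if infDist y.1 C0 ≤ 4 * |y.2| ∧ |y.2| < 3 then ENNReal.ofReal (|y.2| ^ (-q)) else 0) :=
    Measurable.ite hset (by fun_prop) measurable_const
  rw [Measure.volume_eq_prod, lintegral_prod_symm' _ hm]
  have hfin : IntegrableOn (fun t : ℝ => K * ‖t‖ ^ (b - q)) (ball (0:ℝ) 3) := by
    rw [integrableOn_fun_norm_addHaar volume (f := fun t : ℝ => K * t ^ (b - q))]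
    simp only [Module.finrank_self, Nat.sub_self, pow_zero, one_smul]
    exact ((intervalIntegral.integrableOn_Ioo_rpow_iff (by norm_num)).2 (by linarith)).const_mul _
  have hfin2 : ∫⁻ t in ball (0:ℝ) 3, ENNReal.ofReal (K * ‖t‖ ^ (b - q)) < ⊤ := by
    have := hfin.hasFiniteIntegral
    rw [hasFiniteIntegral_iff_norm] at this
    exact lt_of_le_of_lt (lintegral_mono fun w => ENNReal.ofReal_le_ofReal (Real.le_norm_self _)) this
  refine lt_of_le_of_lt ?_ hfin2
  rw [← lintegral_indicator measurableSet_ball]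
  apply lintegral_mono_ae
  have hne : ∀ᵐ t : ℝ, t ≠ 0 := by
    rw [ae_iff]; simp
  filter_upwards [hne] with t ht
  have ht0 : 0 < |t| := abs_pos.2 ht
  by_cases h3 : |t| < 3
  · rw [Set.indicator_of_mem (by simpa [mem_ball] using h3)]
    simp only [h3, and_true]
    have hms : MeasurableSet {x : EuclideanSpace ℝ (Fin n) | infDist x C0 ≤ 4 * |t|} :=
      measurableSet_le (by fun_prop) measurable_const
    calc _ = ∫⁻ x : EuclideanSpace ℝ (Fin n), {x : EuclideanSpace ℝ (Fin n) | infDist x C0 ≤ 4 * |t|}.indicator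
          (fun _ => ENNReal.ofReal (|t| ^ (-q))) x := by
          congr 1
      _ = ENNReal.ofReal (|t| ^ (-q)) * volume {x : EuclideanSpace ℝ (Fin n) | infDist x C0 ≤ 4 * |t|} := by
          rw [lintegral_indicator_const hms]
      _ ≤ ENNReal.ofReal (|t| ^ (-q)) * ENNReal.ofReal (K * |t| ^ b) := by
          gcongr
          exact hvol _ ht0 h3.le
      _ = _ := by
          rw [← ENNReal.ofReal_mul (by positivity), Real.norm_eq_abs, sub_eq_add_neg, Real.rpow_add ht0]
          congr 1; ring
  · simp [h3]

lemma sym_fin {X : Type*} [MeasurableSpace X] (μ : Measure X) [SFinite μ] (F : X → X → ℝ≥0∞)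
    (hF : Measurable (Function.uncurry F)) (hA : ∫⁻ y, ∫⁻ z, F y z ∂μ ∂μ < ⊤) :
    ∫⁻ y, ∫⁻ z, (F y z + F z y) ∂μ ∂μ < ⊤ := by
  have hB : ∫⁻ y, ∫⁻ z, F z y ∂μ ∂μ < ⊤ := by
    rw [lintegral_lintegral_swap (f := fun y z => F z y)]
    · exact hA
    · exact (hF.comp measurable_swap).aemeasurable
  have e1 : ∀ y, ∫⁻ z, (F y z + F z y) ∂μ = (∫⁻ z, F y z ∂μ) + ∫⁻ z, F z y ∂μ := fun y =>
    lintegral_add_left (hF.comp measurable_prodMk_left) _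
  simp only [e1]
  have hm : Measurable fun y => ∫⁻ z, F y z ∂μ := hF.lintegral_prod_right'
  rw [lintegral_add_left hm]
  exact ENNReal.add_lt_top.2 ⟨hA, hB⟩

set_option maxHeartbeats 1000000 in
lemma main_fin (n : ℕ) (l : ℝ) (hl : l ∈ Set.Ioo (0:ℝ) (1/2))
    (s p : ℝ) (hs : s ∈ Set.Ioo (0:ℝ) 1) (hp : 1 < p)
    (hq : s * p < (n:ℝ) + 1 - n * Real.log 2 / Real.log (1/l))
    (C0 : Set (EuclideanSpace ℝ (Fin n)))
    (hC0 : C0 = {x : EuclideanSpace ℝ (Fin n) | ∀ i, x i ∈ cantorSetMid l})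
    (c : ℝ) (hc : 0 < c)
    (u : (EuclideanSpace ℝ (Fin n) × ℝ) → ℝ)
    (hu0 : ∀ x, ¬ infDist x.1 C0 ≤ 4 * |x.2| → u x = 0)
    (hlip : ∀ y z, y.2 ≠ 0 → |u y - u z| ≤ min 1 (c * dist y z / |y.2|)) :
    (∫⁻ y in {x : EuclideanSpace ℝ (Fin n) × ℝ | (∀ i, |x.1 i| < 3) ∧ |x.2| < 3},
      ∫⁻ z in {x : EuclideanSpace ℝ (Fin n) × ℝ | (∀ i, |x.1 i| < 3) ∧ |x.2| < 3},
        ENNReal.ofReal (|u y - u z| ^ p / dist y z ^ ((n:ℝ) + 1 + s * p))) < ⊤ := by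
  set W := {x : EuclideanSpace ℝ (Fin n) × ℝ | (∀ i, |x.1 i| < 3) ∧ |x.2| < 3} with hW
  set e := (n:ℝ) + 1 + s * p with he
  have hWm : MeasurableSet W := by
    have : W = (⋂ i, {x : EuclideanSpace ℝ (Fin n) × ℝ | |x.1 i| < 3}) ∩ {x | |x.2| < 3} := by
      ext x; simp [hW]
    rw [this]
    refine (MeasurableSet.iInter fun i => ?_).inter ?_
    · exact measurableSet_lt (by fun_prop) measurable_const
    · exact measurableSet_lt (by fun_prop) measurable_const
  let F : (EuclideanSpace ℝ (Fin n) × ℝ) → (EuclideanSpace ℝ (Fin n) × ℝ) → ℝ≥0∞ := fun y z =>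
    if infDist y.1 C0 ≤ 4 * |y.2| then (if y.2 = 0 then ⊤ else
      ENNReal.ofReal ((min 1 (c * dist y z / |y.2|)) ^ p / dist y z ^ e)) else 0
  have hFm : Measurable (Function.uncurry F) := by
    refine Measurable.ite ?_ (Measurable.ite ?_ measurable_const ?_) measurable_const
    · exact measurableSet_le (by fun_prop) (by fun_prop)
    · exact measurableSet_eq_fun (by fun_prop) measurable_const
    · fun_prop
  have hone : ∀ y z, infDist y.1 C0 ≤ 4 * |y.2| →
      ENNReal.ofReal (|u y - u z| ^ p / dist y z ^ e) ≤ F y z := by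
    intro y z hy
    simp only [F, if_pos hy]
    split_ifs with h
    · exact le_top
    · apply ENNReal.ofReal_le_ofReal
      have := hlip y z h
      gcongr
  have hpt : ∀ y z, ENNReal.ofReal (|u y - u z| ^ p / dist y z ^ e) ≤ F y z + F z y := by
    intro y z
    by_cases hy : infDist y.1 C0 ≤ 4 * |y.2|
    · exact (hone y z hy).trans le_self_add
    by_cases hz : infDist z.1 C0 ≤ 4 * |z.2|
    · rw [abs_sub_comm, dist_comm]
      exact (hone z y hz).trans le_add_self
    · rw [hu0 y hy, hu0 z hz]
      simp [Real.zero_rpow (by linarith : p ≠ 0)]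
  have hA : ∫⁻ y in W, ∫⁻ z in W, F y z < ⊤ := by
    have hK0 := K0_fin n c p s hc hp hs
    set K0 := ∫⁻ w : EuclideanSpace ℝ (Fin n) × ℝ, ENNReal.ofReal (gker c p ((n:ℝ) + 1 + s * p) ‖w‖)
    have hcone := cone_int n l hl (s * p) hq C0 hC0
    have hne : ∀ᵐ y : EuclideanSpace ℝ (Fin n) × ℝ, y.2 ≠ 0 := by
      have : ∀ᵐ t : ℝ, t ≠ 0 := by
        rw [ae_iff]; simp
      exact Measure.quasiMeasurePreserving_snd.ae this
    set H : EuclideanSpace ℝ (Fin n) × ℝ → ℝ≥0∞ := fun y =>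
      (if infDist y.1 C0 ≤ 4 * |y.2| ∧ |y.2| < 3 then
        ENNReal.ofReal (|y.2| ^ (-(s * p))) else 0) with hH
    have s1 : ∫⁻ y in W, ∫⁻ z in W, F y z ≤ ∫⁻ y in W, H y * K0 := by
      apply lintegral_mono_ae
      filter_upwards [ae_restrict_of_ae hne, ae_restrict_mem hWm] with y hy hyW
      refine (setLIntegral_le_lintegral _ _).trans ?_
      by_cases hM : infDist y.1 C0 ≤ 4 * |y.2|
      · have e1 : H y = ENNReal.ofReal (|y.2| ^ (-(s * p))) := if_pos ⟨hM, hyW.2⟩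
        simp only [F, if_pos hM, if_neg hy]
        rw [e1]
        exact (scale n c p s |y.2| (abs_pos.2 hy) y).le
      · simp [F, hM]
    have s2 : ∫⁻ y in W, H y * K0 ≤ (∫⁻ y, H y) * K0 := by
      rw [← lintegral_mul_const' K0 H hK0.ne]
      exact setLIntegral_le_lintegral W (fun y => H y * K0)
    exact (s1.trans s2).trans_lt (ENNReal.mul_lt_top hcone hK0)
  refine lt_of_le_of_lt (lintegral_mono fun y => lintegral_mono fun z => hpt y z) ?_
  exact sym_fin (volume.restrict W) F hFm hA

/-- Finiteness of the `s,p`-Gagliardo energy of the subcritical competitor on `3Ω × 3Ω`,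
under the condition `s - (d - 𝔇)/p < 0` with `𝔇 = (d-1) log 2 / log(1/l)`. -/
theorem stmt_8 (d : ℕ) (hd : 2 ≤ d) (l : ℝ) (hl : l ∈ Set.Ioo (0:ℝ) (1/2))
    (s p : ℝ) (hs : s ∈ Set.Ioo (0:ℝ) 1) (hp : 1 < p)
    (D : ℝ) (hD : D = ((d:ℝ) - 1) * Real.log 2 / Real.log (1/l))
    (hcond : s - ((d:ℝ) - D) / p < 0)
    (C0 : Set (EuclideanSpace ℝ (Fin (d-1))))
    (hC0 : C0 = {x : EuclideanSpace ℝ (Fin (d-1)) | ∀ i, x i ∈ cantorSetMid l})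
    (ρ : (EuclideanSpace ℝ (Fin (d-1)) × ℝ) → ℝ)
    (hρ1 : ∀ x : EuclideanSpace ℝ (Fin (d-1)) × ℝ,
      (if Metric.infDist x.1 C0 ≤ 2 * |x.2| then (1:ℝ) else 0) ≤ ρ x)
    (hρ2 : ∀ x : EuclideanSpace ℝ (Fin (d-1)) × ℝ,
      ρ x ≤ (if Metric.infDist x.1 C0 ≤ 4 * |x.2| then (1:ℝ) else 0))
    (hsmooth : ContDiffOn ℝ (⊤ : ℕ∞) ρ {x : EuclideanSpace ℝ (Fin (d-1)) × ℝ |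
      ¬(x.1 ∈ C0 ∧ x.2 = 0)})
    (c₁ : ℝ)
    (hgrad : ∀ x : EuclideanSpace ℝ (Fin (d-1)) × ℝ,
      ‖fderiv ℝ ρ x‖ ≤ c₁ * |x.2|⁻¹ *
        (if 2 * |x.2| ≤ Metric.infDist x.1 C0 ∧ Metric.infDist x.1 C0 ≤ 4 * |x.2|
          then (1:ℝ) else 0))
    (u : (EuclideanSpace ℝ (Fin (d-1)) × ℝ) → ℝ)
    (hu : ∀ x, u x = (1/2) * Real.sign x.2 * ρ x) :
    (∫⁻ y in {x : EuclideanSpace ℝ (Fin (d-1)) × ℝ | (∀ i, |x.1 i| < 3) ∧ |x.2| < 3},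
      ∫⁻ z in {x : EuclideanSpace ℝ (Fin (d-1)) × ℝ | (∀ i, |x.1 i| < 3) ∧ |x.2| < 3},
        ENNReal.ofReal (|u y - u z| ^ p / dist y z ^ ((d:ℝ) + s * p))) < ⊤ := by
  have hn : ((d - 1 : ℕ) : ℝ) + 1 = d := by
    rw [Nat.cast_sub (by omega)]; simp
  have hn' : (d:ℝ) - 1 = ((d - 1 : ℕ) : ℝ) := by linarith
  have hp0 : 0 < p := by linarith
  have hρ0 : ∀ x, 0 ≤ ρ x := fun x => le_trans (by split_ifs <;> norm_num) (hρ1 x)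
  have hρ1' : ∀ x, ρ x ≤ 1 := fun x => (hρ2 x).trans (by split_ifs <;> norm_num)
  have hgrad' : ∀ x : EuclideanSpace ℝ (Fin (d-1)) × ℝ, ‖fderiv ℝ ρ x‖ ≤ |c₁| * |x.2|⁻¹ := by
    intro x
    have h1 : c₁ * |x.2|⁻¹ ≤ |c₁| * |x.2|⁻¹ := by gcongr; exact le_abs_self _
    have h2 : 0 ≤ |c₁| * |x.2|⁻¹ := by positivity
    refine (hgrad x).trans ?_
    split_ifs
    · simpa using h1
    · simpa using h2
  have hq : s * p < ((d - 1 : ℕ) : ℝ) + 1 -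
      ((d - 1 : ℕ) : ℝ) * Real.log 2 / Real.log (1/l) := by
    rw [hn, ← hn', ← hD]
    have : s < ((d:ℝ) - D) / p := by linarith
    rwa [lt_div_iff₀ hp0] at this
  have := main_fin (d - 1) l hl s p hs hp hq C0 hC0 (2 + |c₁|) (by positivity) u
    (fun x hx => by
      have h := hρ2 x
      rw [if_neg hx] at h
      rw [hu, le_antisymm h (hρ0 x), mul_zero])
    (fun y z hy => lip (d - 1) C0 ρ hρ0 hρ1' hsmooth c₁ hgrad' u hu y z hy)
  rwa [hn] at this
end

section
/- Let K⁺ = {y ∈ ℝ^d : |ȳ| ≤ y_d/4, 0 < y_d ≤ 2}, let l ∈ (0,1/2), and let Q_l⁺ = {x : |x̄| ≤ l/4, l ≤ x_d ≤ 2l}. Then for every z ∈ ℝ^d with z_d > 0, the average (1/|Q_l⁺|) ∫_{Q_l⁺} |z − x|^{−(d−1)} dx ≤ C(d) · |z|^{−(d−1)} whenever z ∈ K⁺ (up to a dimensional constant), so that by Jensen's inequality and the fundamental theorem of calculus, for v ∈ C¹ with v = 1/2 on the top face {x_d = 1} of (−1,1)^d, |1/2 − ⟨v⟩_{Q_l⁺}|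 ≤ C ∫_{K⁺} |∇v(z)| / |z|^{d−1} dz. -/
open MeasureTheory Set Metric Filter
open scoped Pointwise ENNReal

/-- The cone `K⁺` in `ℝ^n × ℝ`. -/
def Kplus (n : ℕ) : Set (EuclideanSpace ℝ (Fin n) × ℝ) :=
  {y | ‖y.1‖ ≤ y.2 / 4 ∧ 0 < y.2 ∧ y.2 ≤ 2}

/-- The box `Q_l⁺ = {|x̄| ≤ l/4, l ≤ x_d ≤ 2l}`. -/
def Qplus (n : ℕ) (lQ : ℝ) : Set (EuclideanSpace ℝ (Fin n) × ℝ) :=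
  {x | ‖x.1‖ ≤ lQ / 4 ∧ lQ ≤ x.2 ∧ x.2 ≤ 2 * lQ}

lemma riesz_ball (n : ℕ) {R : ℝ} (hR : 0 < R) :
    Integrable (fun y : EuclideanSpace ℝ (Fin n) × ℝ =>
      (Set.Iio R).indicator (fun t : ℝ => t ^ (-(n:ℝ))) ‖y‖) ∧
    ∫ y : EuclideanSpace ℝ (Fin n) × ℝ, (Set.Iio R).indicator (fun t : ℝ => t ^ (-(n:ℝ))) ‖y‖
      = (n+1) * volume.real (ball (0 : EuclideanSpace ℝ (Fin n) × ℝ) 1) * R := by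
  have hd : Module.finrank ℝ (EuclideanSpace ℝ (Fin n) × ℝ) = n + 1 := by simp
  have hv : (volume : Measure (EuclideanSpace ℝ (Fin n) × ℝ)).IsAddHaarMeasure := by
    rw [Measure.volume_eq_prod]; infer_instance
  have key : ∀ y ∈ Set.Ioi (0:ℝ), y ^ (n + 1 - 1) • (Set.Iio R).indicator (fun t : ℝ => t ^ (-(n:ℝ))) y
      = (Set.Iio R).indicator (fun _ => (1:ℝ)) y := by
    intro y hy
    have hy : 0 < y := hy
    by_cases h : y < R
    · simp only [Set.indicator, Set.mem_Iio, h, if_true, smul_eq_mul, Nat.add_sub_cancel]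
      rw [Real.rpow_neg hy.le, Real.rpow_natCast]
      exact mul_inv_cancel₀ (by positivity)
    · simp [Set.indicator, h]
  constructor
  · rw [integrable_fun_norm_addHaar volume
      (f := (Set.Iio R).indicator (fun t : ℝ => t ^ (-(n:ℝ)))), hd,
      integrableOn_congr_fun key measurableSet_Ioi]
    rw [IntegrableOn, integrable_indicator_iff measurableSet_Iio, IntegrableOn,
      Measure.restrict_restrict measurableSet_Iio]
    have : Set.Iio R ∩ Set.Ioi 0 = Set.Ioo 0 R := by ext; simp [and_comm]
    rw [this]
    exact integrableOn_const (by simp)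
  · rw [integral_fun_norm_addHaar volume
      ((Set.Iio R).indicator (fun t : ℝ => t ^ (-(n:ℝ)))), hd,
      setIntegral_congr_fun measurableSet_Ioi key,
      integral_indicator measurableSet_Iio, Measure.restrict_restrict measurableSet_Iio]
    have : Set.Iio R ∩ Set.Ioi 0 = Set.Ioo 0 R := by ext; simp [and_comm]
    rw [this]
    simp [hR.le]
    ring

lemma Q_eq (n : ℕ) (l : ℝ) :
    Qplus n l = closedBall (0 : EuclideanSpace ℝ (Fin n)) (l/4) ×ˢ Set.Icc l (2*l) := by
  ext x; simp [Qplus]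

lemma Q_vol (n : ℕ) {l : ℝ} (hl : 0 < l) :
    (volume (Qplus n l)).toReal
      = (l/4)^n * volume.real (ball (0 : EuclideanSpace ℝ (Fin n)) 1) * l := by
  rw [Q_eq, Measure.volume_eq_prod, Measure.prod_prod, ENNReal.toReal_mul,
    Measure.addHaar_closedBall _ _ (by positivity), ENNReal.toReal_mul,
    ENNReal.toReal_ofReal (by positivity), Real.volume_Icc, ENNReal.toReal_ofReal (by linarith)]
  simp [Measure.real]
  left; ring

lemma Q_meas (n : ℕ) (l : ℝ) : MeasurableSet (Qplus n l) := by
  rw [Q_eq]; exact isClosed_closedBall.measurableSet.prod measurableSet_Icc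

lemma Q_compact (n : ℕ) (l : ℝ) : IsCompact (Qplus n l) := by
  rw [Q_eq]; exact (isCompact_closedBall _ _).prod isCompact_Icc

lemma K_meas (n : ℕ) : MeasurableSet (Kplus n) := by
  have h1 : MeasurableSet {y : EuclideanSpace ℝ (Fin n) × ℝ | ‖y.1‖ ≤ y.2 / 4} :=
    measurableSet_le (by fun_prop) (by fun_prop)
  have h2 : MeasurableSet {y : EuclideanSpace ℝ (Fin n) × ℝ | 0 < y.2} :=
    measurableSet_lt (by fun_prop) (by fun_prop)
  have h3 : MeasurableSet {y : EuclideanSpace ℝ (Fin n) × ℝ | y.2 ≤ 2} :=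
    measurableSet_le (by fun_prop) (by fun_prop)
  exact h1.inter (h2.inter h3)

lemma K_norm (n : ℕ) {z : EuclideanSpace ℝ (Fin n) × ℝ} (hz : z ∈ Kplus n) : ‖z‖ = z.2 := by
  obtain ⟨h1, h2, h3⟩ := hz
  rw [Prod.norm_def, Real.norm_eq_abs, abs_of_pos h2]
  exact max_eq_right (by linarith)

lemma part1 (n : ℕ) {l : ℝ} (hl : 0 < l) (z : EuclideanSpace ℝ (Fin n) × ℝ) (hz : z ∈ Kplus n) :
    (∫ x in Qplus n l, dist z x ^ (-(n:ℝ))) / (volume (Qplus n l)).toReal ≤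
      (2^n + (n+1) * volume.real (ball (0 : EuclideanSpace ℝ (Fin n) × ℝ) 1) * 6 * 16^n /
        volume.real (ball (0 : EuclideanSpace ℝ (Fin n)) 1)) * ‖z‖ ^ (-(n:ℝ)) := by
  have hω : 0 < volume.real (ball (0 : EuclideanSpace ℝ (Fin n)) 1) :=
    ENNReal.toReal_pos (measure_ball_pos _ _ one_pos).ne' measure_ball_lt_top.ne
  have hB : 0 ≤ volume.real (ball (0 : EuclideanSpace ℝ (Fin n) × ℝ) 1) := measureReal_nonneg
  have hQ := Q_vol n hl
  have hQpos : 0 < (volume (Qplus n l)).toReal := by rw [hQ]; positivity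
  have hvol : (volume : Measure (EuclideanSpace ℝ (Fin n) × ℝ)).IsAddHaarMeasure := by
    rw [Measure.volume_eq_prod]; infer_instance
  rw [K_norm n hz]
  obtain ⟨h1, h2, h3⟩ := hz
  set ω := volume.real (ball (0 : EuclideanSpace ℝ (Fin n)) 1)
  set B := volume.real (ball (0 : EuclideanSpace ℝ (Fin n) × ℝ) 1)
  have hzr : z.2 ^ (-(n:ℝ)) = (z.2^n)⁻¹ := by rw [Real.rpow_neg h2.le, Real.rpow_natCast]
  rcases le_or_gt (z.2) (4*l) with h | h
  · have hf := riesz_ball n (R := 6*l) (by positivity)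
    have : ∫ x in Qplus n l, dist z x ^ (-(n:ℝ)) ≤ (n+1) * B * (6*l) := by
      rw [← hf.2, ← integral_sub_left_eq_self _ volume z, ← integral_indicator (Q_meas n l)]
      apply integral_mono_of_nonneg
      · refine Eventually.of_forall fun x => ?_
        apply Set.indicator_nonneg
        intro x _
        positivity
      · exact hf.1.comp_sub_left z
      · refine Eventually.of_forall fun x => ?_
        by_cases hx : x ∈ Qplus n l
        · have : ‖z - x‖ < 6 * l := by
            obtain ⟨q1, q2, q3⟩ := hx
            rw [Prod.norm_def, max_lt_iff]
            constructor
            · calc ‖(z-x).1‖ ≤ ‖z.1‖ + ‖x.1‖ := norm_sub_le _ _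
                _ < _ := by linarith
            · rw [Real.norm_eq_abs, abs_lt]
              constructor <;> simp <;> linarith
          simp only [Set.indicator, hx, if_true, Set.mem_Iio, this, dist_eq_norm]
          exact le_rfl
        · simp only [Set.indicator, hx, if_false]
          split_ifs
          · positivity
          · exact le_rfl
    rw [hzr]
    calc _ ≤ (n+1) * B * (6*l) / (volume (Qplus n l)).toReal := by gcongr
      _ = ((n+1) * B * 6 * 16^n / ω) * ((4*l)^n)⁻¹ := by
        rw [hQ, div_pow, mul_pow, show (16:ℝ) = 4*4 by norm_num, mul_pow]
        field_simp
      _ ≤ ((n+1) * B * 6 * 16^n / ω) * (z.2^n)⁻¹ := by gcongr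
      _ ≤ _ := by
        gcongr
        have : (0:ℝ) ≤ 2^n := by positivity
        linarith
  · have : ∫ x in Qplus n l, dist z x ^ (-(n:ℝ)) ≤ (2^n * (z.2^n)⁻¹) * (volume (Qplus n l)).toReal := by
      apply (le_abs_self _).trans
      refine norm_setIntegral_le_of_norm_le_const (μ := volume)
        (f := fun x => dist z x ^ (-(n:ℝ))) (Q_compact n l).measure_lt_top ?_
      intro x hx
      obtain ⟨q1, q2, q3⟩ := hx
      have hd : z.2 / 2 ≤ dist z x := by
        rw [dist_eq_norm]
        calc z.2/2 ≤ z.2 - x.2 := by linarith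
          _ ≤ |z.2 - x.2| := le_abs_self _
          _ ≤ _ := norm_snd_le (z - x)
      have hd0 : 0 < dist z x := by linarith
      rw [Real.rpow_neg hd0.le, Real.rpow_natCast, norm_inv, norm_pow, Real.norm_of_nonneg hd0.le]
      calc (dist z x ^ n)⁻¹ ≤ ((z.2/2)^n)⁻¹ := by gcongr
        _ = _ := by rw [div_pow]; field_simp
    rw [div_le_iff₀ hQpos, hzr]
    apply this.trans
    gcongr
    have : 0 ≤ (n+1) * B * 6 * 16^n / ω := by positivity
    linarith

lemma pointwise (n : ℕ) (v : EuclideanSpace ℝ (Fin n) × ℝ → ℝ) (hv : ContDiff ℝ 1 v)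
    (htop : ∀ x : EuclideanSpace ℝ (Fin n) × ℝ, x.2 = 1 → v x = 1/2)
    {a : EuclideanSpace ℝ (Fin n)} {b : ℝ} (hb : 0 < b) (hb1 : b ≤ 1) (hab : ‖a‖ ≤ b/4) :
    ‖1/2 - v (a,b)‖ₑ ≤
      ∫⁻ s in Set.Ioi (0:ℝ), (Kplus n).indicator (fun z => ‖fderiv ℝ v z‖ₑ) ((s/b) • a, s) := by
  set γ : ℝ → EuclideanSpace ℝ (Fin n) × ℝ := fun s => ((s/b) • a, s) with hγ
  have hγd : ∀ s, HasDerivAt γ (b⁻¹ • a, 1) s := by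
    intro s
    apply HasDerivAt.prodMk
    · have := ((hasDerivAt_id s).div_const b).smul_const a
      simpa using this
    · exact hasDerivAt_id s
  have hγc : Continuous γ := by fun_prop
  have hfc : Continuous (fun s => fderiv ℝ v (γ s)) :=
    (hv.continuous_fderiv (by norm_num)).comp hγc
  have hd : ∀ s ∈ Set.uIcc b 1, HasDerivAt (fun s => v (γ s)) (fderiv ℝ v (γ s) (b⁻¹ • a, 1)) s := by
    intro s _
    exact ((hv.differentiable (by norm_num)) (γ s)).hasFDerivAt.comp_hasDerivAt s (hγd s)
  have hF := intervalIntegral.integral_eq_sub_of_hasDerivAt hd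
    ((hfc.clm_apply continuous_const).intervalIntegrable _ _)
  have e1 : v (γ 1) = 1/2 := htop _ rfl
  have e2 : γ b = (a, b) := by simp [hγ, hb.ne']
  rw [e1, e2] at hF
  rw [← hF, intervalIntegral.integral_of_le hb1]
  refine (enorm_integral_le_lintegral_enorm _).trans ?_
  have hsub : Set.Ioc b 1 ⊆ Set.Ioi 0 := fun s hs => hb.trans hs.1
  refine le_trans ?_ (lintegral_mono_set hsub)
  refine setLIntegral_mono' measurableSet_Ioc fun s hs => ?_
  have hs0 : 0 < s := hb.trans hs.1
  have hK : γ s ∈ Kplus n := by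
    refine ⟨?_, hs0, by have := hs.2; simp only [hγ]; linarith⟩
    simp only [hγ, norm_smul]
    rw [Real.norm_of_nonneg (by positivity)]
    calc s/b*‖a‖ ≤ s/b*(b/4) := by gcongr
      _ = s/4 := by field_simp
  have : ((s/b) • a, s) = γ s := rfl
  rw [this, Set.indicator_of_mem hK]
  have hn1 : ‖(b⁻¹ • a, (1:ℝ))‖ ≤ 1 := by
    rw [Prod.norm_def, max_le_iff]
    refine ⟨?_, by simp⟩
    simp only [norm_smul]
    rw [Real.norm_of_nonneg (by positivity)]
    calc b⁻¹ * ‖a‖ ≤ b⁻¹*(b/4) := by gcongr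
      _ = 1/4 := by field_simp
      _ ≤ 1 := by norm_num
  rw [enorm_le_iff_norm_le]
  calc _ ≤ ‖fderiv ℝ v (γ s)‖ * ‖(b⁻¹ • a, (1:ℝ))‖ := ContinuousLinearMap.le_opNorm _ _
    _ ≤ ‖fderiv ℝ v (γ s)‖ * 1 := by gcongr
    _ = _ := mul_one _

lemma scale_s11 (n : ℕ) (G : EuclideanSpace ℝ (Fin n) × ℝ → ℝ≥0∞) (hG : Measurable G)
    {b : ℝ} (hb : 0 < b) :
    ∫⁻ a, ∫⁻ s in Set.Ioi (0:ℝ), G ((s/b) • a, s) =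
      ENNReal.ofReal (b^n) * ∫⁻ s in Set.Ioi (0:ℝ), ∫⁻ a, ENNReal.ofReal (s ^ (-(n:ℝ))) * G (a, s) := by
  rw [lintegral_lintegral_swap, ← lintegral_const_mul]
  · refine setLIntegral_congr_fun measurableSet_Ioi fun s hs => ?_
    have hs : 0 < s := hs
    have hsb : s/b ≠ 0 := by positivity
    have h1 := lintegral_map (μ := (volume : Measure (EuclideanSpace ℝ (Fin n))))
      (f := fun a => G (a, s)) (g := fun a => (s/b) • a) (by fun_prop) (by fun_prop)
    rw [← h1, Measure.map_addHaar_smul _ hsb, lintegral_smul_measure, lintegral_const_mul _ (by fun_prop),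
      ← mul_assoc, ← ENNReal.ofReal_mul (by positivity), smul_eq_mul]
    congr 2
    rw [Real.rpow_neg hs.le, Real.rpow_natCast, abs_of_nonneg (by positivity), div_pow]
    simp
    field_simp
  · refine Measurable.lintegral_prod_right'
      (f := fun p : ℝ × EuclideanSpace ℝ (Fin n) => ENNReal.ofReal (p.1 ^ (-(n:ℝ))) * G (p.2, p.1)) ?_
    fun_prop
  · apply Measurable.aemeasurable
    change Measurable (fun p : EuclideanSpace ℝ (Fin n) × ℝ => G ((p.2/b) • p.1, p.2))
    fun_prop

lemma Kint (n : ℕ) (v : EuclideanSpace ℝ (Fin n) × ℝ → ℝ) (hv : ContDiff ℝ 1 v) :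
    IntegrableOn (fun z => ‖fderiv ℝ v z‖ * ‖z‖ ^ (-(n:ℝ))) (Kplus n) := by
  have hc : Continuous (fderiv ℝ v) := hv.continuous_fderiv (by norm_num)
  obtain ⟨M, hM⟩ := (isCompact_closedBall (0 : EuclideanSpace ℝ (Fin n) × ℝ) 2).exists_bound_of_continuousOn
    hc.continuousOn
  have hf := (riesz_ball n (R := 3) (by norm_num)).1
  refine Integrable.mono' ((hf.const_mul M).integrableOn (s := Kplus n)) ?_ ?_
  · apply Measurable.aestronglyMeasurable
    have := hc.measurable
    fun_prop
  · refine (ae_restrict_iff' (K_meas n)).2 (Eventually.of_forall fun z hz => ?_)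
    have hz2 : ‖z‖ ≤ 2 := by rw [K_norm n hz]; exact hz.2.2
    have : ‖z‖ < 3 := by linarith
    simp only [Set.indicator, Set.mem_Iio, this, if_true]
    rw [Real.norm_of_nonneg (by positivity)]
    gcongr
    exact hM z (by simpa using hz2)

lemma main2 (n : ℕ) (v : EuclideanSpace ℝ (Fin n) × ℝ → ℝ) (hv : ContDiff ℝ 1 v)
    (htop : ∀ x : EuclideanSpace ℝ (Fin n) × ℝ, x.2 = 1 → v x = 1/2)
    {l : ℝ} (hl : 0 < l) (hl2 : l < 1/2) :
    ∫⁻ x in Qplus n l, ‖1/2 - v x‖ₑ ≤ ENNReal.ofReal ((2*l)^n * l *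
      ∫ z in Kplus n, ‖fderiv ℝ v z‖ * ‖z‖ ^ (-(n:ℝ))) := by
  have hc : Continuous (fderiv ℝ v) := hv.continuous_fderiv (by norm_num)
  have hvc := hv.continuous
  set G : EuclideanSpace ℝ (Fin n) × ℝ → ℝ≥0∞ :=
    (Kplus n).indicator (fun z => ‖fderiv ℝ v z‖ₑ) with hGdef
  have hG : Measurable G := Measurable.indicator (by have := hc.measurable; fun_prop) (K_meas n)
  have hI : ∫⁻ s in Set.Ioi (0:ℝ), ∫⁻ a, ENNReal.ofReal (s ^ (-(n:ℝ))) * G (a, s) =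
      ENNReal.ofReal (∫ z in Kplus n, ‖fderiv ℝ v z‖ * ‖z‖ ^ (-(n:ℝ))) := by
    rw [ofReal_integral_eq_lintegral_ofReal (Kint n v hv)
      (Eventually.of_forall fun z => by positivity)]
    rw [← lintegral_indicator (K_meas n), Measure.volume_eq_prod, lintegral_prod_symm',
      ← lintegral_indicator measurableSet_Ioi]
    · refine lintegral_congr fun s => ?_
      by_cases hs : 0 < s
      · rw [Set.indicator_of_mem (by exact hs)]
        refine lintegral_congr fun a => ?_
        by_cases hK : (a, s) ∈ Kplus n
        · rw [Set.indicator_of_mem hK, hGdef, Set.indicator_of_mem hK, K_norm n hK,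
            ENNReal.ofReal_mul (norm_nonneg _), ofReal_norm, mul_comm]
        · rw [Set.indicator_of_notMem hK, hGdef, Set.indicator_of_notMem hK, mul_zero]
      · rw [Set.indicator_of_notMem (by exact hs)]
        symm
        have : ∀ a : EuclideanSpace ℝ (Fin n), (a, s) ∉ Kplus n := fun a h => hs h.2.1
        simp [this]
    · refine Measurable.indicator ?_ (K_meas n)
      have := hc.measurable
      fun_prop
  have hI0 : 0 ≤ ∫ z in Kplus n, ‖fderiv ℝ v z‖ * ‖z‖ ^ (-(n:ℝ)) :=
    integral_nonneg fun z => by positivity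
  generalize (∫ z in Kplus n, ‖fderiv ℝ v z‖ * ‖z‖ ^ (-(n:ℝ))) = I at hI hI0 ⊢
  rw [Q_eq, Measure.volume_eq_prod, ← Measure.prod_restrict, lintegral_prod_symm' _ (by fun_prop)]
  calc _ ≤ ∫⁻ b in Set.Icc l (2*l), ENNReal.ofReal ((2*l)^n) *
        ENNReal.ofReal I := by
        refine setLIntegral_mono' measurableSet_Icc fun b hb => ?_
        have hb0 : 0 < b := hl.trans_le hb.1
        calc _ ≤ ∫⁻ a in closedBall (0 : EuclideanSpace ℝ (Fin n)) (l/4),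
              ∫⁻ s in Set.Ioi (0:ℝ), G ((s/b) • a, s) := by
              refine setLIntegral_mono' isClosed_closedBall.measurableSet fun a ha => ?_
              refine pointwise n v hv htop hb0 (by linarith [hb.2]) ?_
              have : ‖a‖ ≤ l/4 := by simpa using ha
              linarith [hb.1]
          _ ≤ ∫⁻ a, ∫⁻ s in Set.Ioi (0:ℝ), G ((s/b) • a, s) := setLIntegral_le_lintegral _ _
          _ = _ := scale_s11 n G hG hb0
          _ ≤ _ := by
            rw [hI]
            gcongr
            exact hb.2
    _ = _ := by
        rw [setLIntegral_const, Real.volume_Icc, ← ENNReal.ofReal_mul (by positivity),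
          ← ENNReal.ofReal_mul (by positivity)]
        congr 1; ring

lemma part2 (n : ℕ) (v : EuclideanSpace ℝ (Fin n) × ℝ → ℝ) (hv : ContDiff ℝ 1 v)
    (htop : ∀ x : EuclideanSpace ℝ (Fin n) × ℝ, x.2 = 1 → v x = 1/2)
    {l : ℝ} (hl : 0 < l) (hl2 : l < 1/2) :
    |1/2 - (∫ x in Qplus n l, v x) / (volume (Qplus n l)).toReal| ≤
      (8^n / volume.real (ball (0 : EuclideanSpace ℝ (Fin n)) 1)) *
        ∫ z in Kplus n, ‖fderiv ℝ v z‖ * ‖z‖ ^ (-(n:ℝ)) := by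
  have hω : 0 < volume.real (ball (0 : EuclideanSpace ℝ (Fin n)) 1) :=
    ENNReal.toReal_pos (measure_ball_pos _ _ one_pos).ne' measure_ball_lt_top.ne
  have hQ := Q_vol n hl
  have hQpos : 0 < (volume (Qplus n l)).toReal := by rw [hQ]; positivity
  have hm := main2 n v hv htop hl hl2
  have hI0 : 0 ≤ ∫ z in Kplus n, ‖fderiv ℝ v z‖ * ‖z‖ ^ (-(n:ℝ)) :=
    integral_nonneg fun z => by positivity
  set I := ∫ z in Kplus n, ‖fderiv ℝ v z‖ * ‖z‖ ^ (-(n:ℝ))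
  have hvi : IntegrableOn v (Qplus n l) := hv.continuous.continuousOn.integrableOn_compact (Q_compact n l)
  have h1 : ∫ x in Qplus n l, (1/2 - v x) =
      1/2 * (volume (Qplus n l)).toReal - ∫ x in Qplus n l, v x := by
    have hci : IntegrableOn (fun _ => (1/2 : ℝ)) (Qplus n l) :=
      continuousOn_const.integrableOn_compact (Q_compact n l)
    rw [integral_sub hci hvi, setIntegral_const]
    simp [Measure.real, mul_comm]
  have h2 : 1/2 - (∫ x in Qplus n l, v x) / (volume (Qplus n l)).toReal =
      (∫ x in Qplus n l, (1/2 - v x)) / (volume (Qplus n l)).toReal := by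
    rw [h1]; field_simp
  have h3 : ‖∫ x in Qplus n l, (1/2 - v x)‖ₑ ≤ ENNReal.ofReal ((2*l)^n * l * I) :=
    (enorm_integral_le_lintegral_enorm _).trans hm
  have h4 : |∫ x in Qplus n l, (1/2 - v x)| ≤ (2*l)^n * l * I := by
    rw [← ofReal_norm, ENNReal.ofReal_le_ofReal_iff (by positivity)] at h3
    exact h3
  rw [h2, abs_div, abs_of_pos hQpos, div_le_iff₀ hQpos]
  refine h4.trans (le_of_eq ?_)
  rw [hQ, div_pow, mul_pow, show (8:ℝ) = 2*4 by norm_num, mul_pow]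
  field_simp

/-- Averaging the Riesz kernel over the box `Q_l⁺` is bounded by `C|z|^{-(d-1)}` for
`z` in the cone `K⁺`; consequently, for `v ∈ C¹` with `v = 1/2` on the top face,
`|1/2 - ⟨v⟩_{Q_l⁺}| ≤ C ∫_{K⁺} |∇v(z)|/|z|^{d-1} dz`. -/
theorem stmt_11 (n : ℕ) (hn : 1 ≤ n) :
    ∃ C : ℝ, 0 < C ∧
      (∀ lQ : ℝ, lQ ∈ Set.Ioo (0:ℝ) (1/2) → ∀ z : EuclideanSpace ℝ (Fin n) × ℝ,
        z ∈ Kplus n →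
        (∫ x in Qplus n lQ, dist z x ^ (-(n:ℝ))) / (volume (Qplus n lQ)).toReal ≤
          C * ‖z‖ ^ (-(n:ℝ))) ∧
      (∀ v : EuclideanSpace ℝ (Fin n) × ℝ → ℝ, ContDiff ℝ 1 v →
        (∀ x : EuclideanSpace ℝ (Fin n) × ℝ, x.2 = 1 → v x = 1/2) →
        ∀ lQ : ℝ, lQ ∈ Set.Ioo (0:ℝ) (1/2) →
        |1/2 - (∫ x in Qplus n lQ, v x) / (volume (Qplus n lQ)).toReal| ≤
          C * ∫ z in Kplus n, ‖fderiv ℝ v z‖ * ‖z‖ ^ (-(n:ℝ))) := by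
  have hω : 0 < volume.real (ball (0 : EuclideanSpace ℝ (Fin n)) 1) :=
    ENNReal.toReal_pos (measure_ball_pos _ _ one_pos).ne' measure_ball_lt_top.ne
  have hB : 0 ≤ volume.real (ball (0 : EuclideanSpace ℝ (Fin n) × ℝ) 1) := measureReal_nonneg
  refine ⟨(2^n + (n+1) * volume.real (ball (0 : EuclideanSpace ℝ (Fin n) × ℝ) 1) * 6 * 16^n /
        volume.real (ball (0 : EuclideanSpace ℝ (Fin n)) 1)) +
        8^n / volume.real (ball (0 : EuclideanSpace ℝ (Fin n)) 1), by positivity, ?_, ?_⟩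
  · intro l hl z hz
    refine (part1 n hl.1 z hz).trans ?_
    refine mul_le_mul_of_nonneg_right ?_ (by positivity)
    exact le_add_of_nonneg_right (by positivity)
  · intro v hv htop l hl
    refine (part2 n v hv htop hl.1 hl.2).trans ?_
    refine mul_le_mul_of_nonneg_right ?_ (integral_nonneg fun z => by positivity)
    exact le_add_of_nonneg_left (by positivity)
end
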